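/- Let I be a countable index set, (a_i)_{i∈I} a family of positive real numbers, and s a complex number with Re(s) > 3 such that the family (a_i^{Re(s)})_{i∈I} is summable. Then the doubly indexed family (2(k+1)(k+2)·((k+3/2)/a_i)^{-s})_{(i,k) ∈ I×ℕ} is summable, and its sum equals (2·ζ_H(s-2, 3/2) − (1/2)·ζ_H(s, 3/2)) · Σ_{i∈I} a_i^s. (This is the factorization Tr(|𝒟_𝒫|^{-s}) = ζ_{D_{S³}}(s)·ζ_ℒ(s) of the zeta function of the Dirac operator of a packing of 3-spheres with radii (a_i).) -/

import Mathlib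

open Complex

/-- The Hurwitz zeta function `ζ_H(s, 3/2)`: the meromorphic continuation in `s` of
`Σ_{n≥0} (n + 3/2)^{-s}`, obtained from Mathlib's `hurwitzZeta (1/2) s` (continuation of
`Σ_{n≥0} (n + 1/2)^{-s}`) by removing the `n = 0` term `(1/2)^{-s} = 2^s`. -/
noncomputable def hurwitzZeta32 (s : ℂ) : ℂ :=
  HurwitzZeta.hurwitzZeta ((1 / 2 : ℝ) : UnitAddCircle) s - 2 ^ s

lemma hasSum_hz32 (s : ℂ) (hs : 1 < s.re) :
    HasSum (fun k : ℕ => (((k : ℝ) + 3 / 2 : ℝ) : ℂ) ^ (-s)) (hurwitzZeta32 s) := by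
  have h := HurwitzZeta.hasSum_hurwitzZeta_of_one_lt_re (a := 1 / 2)
    ⟨by norm_num, by norm_num⟩ hs
  rw [← hasSum_nat_add_iff' 1] at h
  unfold hurwitzZeta32
  convert h using 1
  · rfl
  · funext k
    rw [Complex.cpow_neg, one_div]
    congr 2
    push_cast
    ring
  · congr 1
    simp only [Finset.sum_range_one, one_div]
    rw [← Complex.cpow_neg]
    have : ((0 : ℕ) : ℂ) + (((2 : ℝ)⁻¹ : ℝ) : ℂ) = (((2 : ℝ)⁻¹ : ℝ) : ℂ) := by simp
    rw [this, Complex.ofReal_inv, Complex.inv_cpow, Complex.cpow_neg, inv_inv]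
    · simp
    · rw [Complex.arg_ofReal_of_nonneg (by norm_num)]
      exact Real.pi_pos.ne

lemma term_eq (b : ℝ) (hb : 0 < b) (s : ℂ) (k : ℕ) :
    (2 * ((k : ℂ) + 1) * ((k : ℂ) + 2)) * ((((k : ℝ) + 3 / 2) / b : ℝ) : ℂ) ^ (-s)
      = (b : ℂ) ^ s * (2 * (((k : ℝ) + 3 / 2 : ℝ) : ℂ) ^ (-(s - 2))
        - 1 / 2 * (((k : ℝ) + 3 / 2 : ℝ) : ℂ) ^ (-s)) := by
  have hx : (0 : ℝ) < (k : ℝ) + 3 / 2 := by positivity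
  have hxc : (((k : ℝ) + 3 / 2 : ℝ) : ℂ) ≠ 0 := by exact_mod_cast hx.ne'
  have e1 : (((k : ℝ) + 3 / 2 : ℝ) : ℂ) ^ (-(s - 2))
      = (((k : ℝ) + 3 / 2 : ℝ) : ℂ) ^ 2 * (((k : ℝ) + 3 / 2 : ℝ) : ℂ) ^ (-s) := by
    rw [show -(s - 2) = 2 + -s by ring, Complex.cpow_add _ _ hxc, Complex.cpow_ofNat]
  have e2 : ((((k : ℝ) + 3 / 2) / b : ℝ) : ℂ) ^ (-s)
      = (((k : ℝ) + 3 / 2 : ℝ) : ℂ) ^ (-s) * (b : ℂ) ^ s := by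
    rw [div_eq_mul_inv, Complex.ofReal_mul,
      Complex.mul_cpow_ofReal_nonneg hx.le (inv_nonneg.2 hb.le), Complex.ofReal_inv,
      Complex.inv_cpow, Complex.cpow_neg (b : ℂ), inv_inv]
    rw [Complex.arg_ofReal_of_nonneg hb.le]
    exact Real.pi_pos.ne
  simp only [e1, e2]
  generalize (((k : ℝ) + 3 / 2 : ℝ) : ℂ) ^ (-s) = y
  push_cast
  ring

lemma hasSum_mul_aux {I : Type*} (f : I → ℂ) (g : ℕ → ℂ) (y : ℂ)
    (hf : Summable fun i => ‖f i‖) (hg : HasSum g y) :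
    HasSum (fun p : I × ℕ => f p.1 * g p.2) ((∑' i, f i) * y) := by
  have hgn : Summable fun k => ‖g k‖ := hg.summable.norm
  have h := summable_mul_of_summable_norm hf hgn
  have hf' : Summable f := hf.of_norm
  exact hf'.hasSum.mul hg h

theorem stmt4 {I : Type*} [Countable I] (a : I → ℝ) (ha : ∀ i, 0 < a i)
    (s : ℂ) (hs : 3 < s.re) (hsum : Summable fun i => a i ^ s.re) :
    HasSum (fun p : I × ℕ =>
        (2 * ((p.2 : ℂ) + 1) * ((p.2 : ℂ) + 2)) *
          (((((p.2 : ℕ) : ℝ) + 3 / 2) / a p.1 : ℝ) : ℂ) ^ (-s))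
      ((2 * hurwitzZeta32 (s - 2) - (1 / 2) * hurwitzZeta32 s) * ∑' i, (a i : ℂ) ^ s) := by
  have h1 := hasSum_hz32 (s - 2) (by simp; linarith)
  have h2 := hasSum_hz32 s (by linarith)
  have h3 := (h1.mul_left 2).sub (h2.mul_left (1 / 2))
  have hn : Summable fun i => ‖(a i : ℂ) ^ s‖ := by
    refine hsum.congr fun i => ?_
    rw [Complex.norm_cpow_eq_rpow_re_of_pos (ha i)]
  have h5 := hasSum_mul_aux _ _ _ hn h3
  rw [mul_comm]
  rw [show (fun p : I × ℕ => _) = _ from funext fun p => term_eq (a p.1) (ha p.1) s p.2]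
  exact h5
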